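/- arXiv:2201.07953 — 7 statements merged into one kernel-verified Lean document; each statement's English description precedes it below -/
import Mathlib

section
/- For every A > 0, L > 0, and U, φ₀ ∈ ℝ, the Gaussian ansatz û(x) = A·exp(−x²/L² + i x² U / L + i φ₀) satisfies (1/8)∫_ℝ |û′(x)|² dx − (1/4)∫_ℝ |û(x)|⁴ dx = √π · A² · (√2 (L² U² + 1) − 2 A² L²) / (16 L), where û′ denotes the derivative of û with respect to x. -/
open MeasureTheory Real

/-- The second moment of a Gaussian. -/
theorem integral_sq_mul_exp_neg_mul_sq {b : ℝ} (hb : 0 < b) :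
    ∫ x : ℝ, x ^ 2 * exp (-b * x ^ 2) = √(π / b) / (2 * b) := by
  have hderiv (x : ℝ) : HasDerivAt (fun x : ℝ => x * exp (-b * x ^ 2))
      (exp (-b * x ^ 2) - 2 * b * (x ^ 2 * exp (-b * x ^ 2))) x := by
    refine ((hasDerivAt_id' x).fun_mul
      (((hasDerivAt_pow 2 x).const_mul (-b)).exp)).congr_deriv ?_
    push_cast
    ring
  have h0 : Integrable fun x : ℝ => exp (-b * x ^ 2) := integrable_exp_neg_mul_sq hb
  have h2 : Integrable fun x : ℝ => x ^ 2 * exp (-b * x ^ 2) := by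
    simpa using integrable_rpow_mul_exp_neg_mul_sq hb (by norm_num : (-1 : ℝ) < 2)
  have key := integral_eq_zero_of_hasDerivAt_of_integrable hderiv
    (h0.sub (h2.const_mul (2 * b))) (integrable_mul_exp_neg_mul_sq hb)
  rw [integral_sub h0 (h2.const_mul _), integral_const_mul, integral_gaussian] at key
  rw [eq_div_iff (by positivity)]
  linarith

/-- Energy of the Gaussian ansatz: for `û(x) = A exp(−x²/L² + i x² U/L + i φ₀)` with
`A, L > 0`, one has
`(1/8)∫_ℝ |û′|² dx − (1/4)∫_ℝ |û|⁴ dx = √π A² (√2 (L² U² + 1) − 2 A² L²)/(16 L)`. -/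
theorem stmt9 (A L U φ₀ : ℝ) (hA : 0 < A) (hL : 0 < L) :
    let uh : ℝ → ℂ := fun x =>
      (A : ℂ) * Complex.exp (-(x : ℂ) ^ 2 / (L : ℂ) ^ 2
        + Complex.I * (x : ℂ) ^ 2 * (U : ℂ) / (L : ℂ) + Complex.I * (φ₀ : ℂ))
    (1 / 8 : ℝ) * (∫ x : ℝ, ‖deriv uh x‖ ^ 2) - (1 / 4 : ℝ) * (∫ x : ℝ, ‖uh x‖ ^ 4)
      = Real.sqrt π * A ^ 2 * (Real.sqrt 2 * (L ^ 2 * U ^ 2 + 1) - 2 * A ^ 2 * L ^ 2)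
        / (16 * L) := by
  intro uh
  have hnorm (x : ℝ) : ‖uh x‖ = A * exp (-(x ^ 2 / L ^ 2)) := by
    have hexponent : -(x : ℂ) ^ 2 / (L : ℂ) ^ 2 + Complex.I * (x : ℂ) ^ 2 * (U : ℂ) / (L : ℂ)
        + Complex.I * (φ₀ : ℂ)
        = ((-(x ^ 2 / L ^ 2) : ℝ) : ℂ) + ((x ^ 2 * U / L + φ₀ : ℝ) : ℂ) * Complex.I := by
      push_cast
      ring
    simp only [uh]
    rw [hexponent, norm_mul, Complex.norm_exp, Complex.norm_of_nonneg hA.le,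
      Complex.add_re, Complex.re_ofReal_mul, Complex.I_re, mul_zero, add_zero, Complex.ofReal_re]
  have hderiv (x : ℝ) : HasDerivAt uh
      (uh x * (((-(2 * x / L ^ 2) : ℝ) : ℂ) + ((2 * x * U / L : ℝ) : ℂ) * Complex.I)) x := by
    have hsq : HasDerivAt (fun x : ℝ => (x : ℂ) ^ 2) (2 * (x : ℂ)) x := by
      simpa using (Complex.ofRealCLM.hasDerivAt (x := x)).fun_pow 2
    refine (((((hsq.fun_neg.div_const ((L : ℂ) ^ 2)).fun_add
      (((hsq.const_mul Complex.I).mul_const (U : ℂ)).div_const (L : ℂ))).add_const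
      (Complex.I * (φ₀ : ℂ))).cexp).const_mul (A : ℂ)).congr_deriv ?_
    simp only [uh]
    push_cast
    ring
  have hnorm_deriv (x : ℝ) : ‖deriv uh x‖ ^ 2
      = 4 * A ^ 2 * (L ^ 2 * U ^ 2 + 1) / L ^ 4 * (x ^ 2 * exp (-(2 / L ^ 2) * x ^ 2)) := by
    rw [(hderiv x).deriv, norm_mul, mul_pow, hnorm, mul_pow, ← exp_nat_mul, Complex.sq_norm,
      Complex.normSq_add_mul_I]
    rw [show ((2 : ℕ) : ℝ) * -(x ^ 2 / L ^ 2) = -(2 / L ^ 2) * x ^ 2 by push_cast; ring]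
    field_simp
    ring
  have hnorm_four (x : ℝ) : ‖uh x‖ ^ 4 = A ^ 4 * exp (-(4 / L ^ 2) * x ^ 2) := by
    rw [hnorm, mul_pow, ← exp_nat_mul]
    congr 2
    push_cast
    ring
  have hsqrt_two : √(π / (2 / L ^ 2)) = √π * √2 * L / 2 := by
    rw [sqrt_eq_iff_mul_self_eq (by positivity) (by positivity)]
    field_simp
    rw [sq_sqrt pi_pos.le, sq_sqrt zero_le_two]
  have hsqrt_four : √(π / (4 / L ^ 2)) = √π * L / 2 := by
    rw [sqrt_eq_iff_mul_self_eq (by positivity) (by positivity)]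
    field_simp
    rw [sq_sqrt pi_pos.le]
    ring
  simp_rw [hnorm_deriv, hnorm_four]
  rw [integral_const_mul, integral_const_mul, integral_gaussian,
    integral_sq_mul_exp_neg_mul_sq (by positivity), hsqrt_two, hsqrt_four]
  field_simp
  ring
end

section
/- Let q = (A, L, U, φ) : ℝ → ℝ⁴ be differentiable with A(t) > 0 and L(t) > 0 for all t, and let v(x, t) = A(t)·exp(−x²/L(t)² + i x² U(t)/L(t) + i φ(t)). Then for every t, ∫_ℝ [ −Im(∂v/∂t (x,t) · v(x,t)* ) + (1/8)|∂v/∂x (x,t)|² − (1/4)|v(x,t)|⁴ ] dx = (√π A² / (16 L)) · [ √2·( −2 L³ U̇ + L² (2 L̇ U + U² − 8 φ̇) + 1 ) − 2 A² L² ], where all parameters and their time derivatives (denoted by dots) are evaluated at t. -/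
open MeasureTheory Real

theorem integrable_sq_mul_exp_neg_mul_sq {b : ℝ} (hb : 0 < b) :
    Integrable fun x : ℝ => x ^ 2 * exp (-b * x ^ 2) := by
  simpa using integrable_rpow_mul_exp_neg_mul_sq hb (by norm_num : (-1 : ℝ) < 2)

theorem norm_gaussian_ansatz (A L U φ x : ℝ) (hA : 0 ≤ A) :
    ‖(A : ℂ) * Complex.exp (-(x : ℂ) ^ 2 / (L : ℂ) ^ 2
      + Complex.I * (x : ℂ) ^ 2 * (U : ℂ) / (L : ℂ) + Complex.I * (φ : ℂ))‖
      = A * exp (-x ^ 2 / L ^ 2) := by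
  rw [norm_mul, Complex.norm_real, Real.norm_of_nonneg hA, Complex.norm_exp]
  have h : -(x : ℂ) ^ 2 / (L : ℂ) ^ 2
      + Complex.I * (x : ℂ) ^ 2 * (U : ℂ) / (L : ℂ) + Complex.I * (φ : ℂ)
      = ((-x ^ 2 / L ^ 2 : ℝ) : ℂ) + ((x ^ 2 * U / L + φ : ℝ) : ℂ) * Complex.I := by
    push_cast
    ring
  rw [h, Complex.add_re, Complex.ofReal_re, Complex.re_ofReal_mul, Complex.I_re, mul_zero, add_zero]

theorem hasDerivAt_gaussian_ansatz_time {A L U φ : ℝ → ℝ} {A' L' U' φ' t : ℝ} (x : ℝ)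
    (hA : HasDerivAt A A' t) (hL : HasDerivAt L L' t) (hU : HasDerivAt U U' t)
    (hφ : HasDerivAt φ φ' t) (hA0 : A t ≠ 0) (hL0 : L t ≠ 0) :
    HasDerivAt (fun s => (A s : ℂ) * Complex.exp (-(x : ℂ) ^ 2 / (L s : ℂ) ^ 2
        + Complex.I * (x : ℂ) ^ 2 * (U s : ℂ) / (L s : ℂ) + Complex.I * (φ s : ℂ)))
      ((((A' / A t + 2 * x ^ 2 * L' / L t ^ 3 : ℝ) : ℂ)
        + ((x ^ 2 * (U' * L t - U t * L') / L t ^ 2 + φ' : ℝ) : ℂ) * Complex.I)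
        * ((A t : ℂ) * Complex.exp (-(x : ℂ) ^ 2 / (L t : ℂ) ^ 2
        + Complex.I * (x : ℂ) ^ 2 * (U t : ℂ) / (L t : ℂ) + Complex.I * (φ t : ℂ)))) t := by
  have hAC : (A t : ℂ) ≠ 0 := Complex.ofReal_ne_zero.mpr hA0
  have hLC : (L t : ℂ) ≠ 0 := Complex.ofReal_ne_zero.mpr hL0
  have h := hA.ofReal_comp.mul
    ((((hasDerivAt_const t (-(x : ℂ) ^ 2)).div (hL.ofReal_comp.pow 2) (pow_ne_zero 2 hLC)).add
      ((hU.ofReal_comp.const_mul (Complex.I * (x : ℂ) ^ 2)).div hL.ofReal_comp hLC)).add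
      (hφ.ofReal_comp.const_mul Complex.I)).cexp
  refine h.congr_deriv ?_
  simp only [Pi.add_apply, Pi.div_apply, Pi.pow_apply]
  generalize Complex.exp _ = E
  push_cast
  field_simp
  ring

theorem hasDerivAt_gaussian_ansatz_space (A L U φ x : ℝ) :
    HasDerivAt (fun y : ℝ => (A : ℂ) * Complex.exp (-(y : ℂ) ^ 2 / (L : ℂ) ^ 2
        + Complex.I * (y : ℂ) ^ 2 * (U : ℂ) / (L : ℂ) + Complex.I * (φ : ℂ)))
      ((((-2 * x / L ^ 2 : ℝ) : ℂ) + ((2 * x * U / L : ℝ) : ℂ) * Complex.I)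
        * ((A : ℂ) * Complex.exp (-(x : ℂ) ^ 2 / (L : ℂ) ^ 2
        + Complex.I * (x : ℂ) ^ 2 * (U : ℂ) / (L : ℂ) + Complex.I * (φ : ℂ)))) x := by
  have hsq := (hasDerivAt_id x).ofReal_comp.pow 2
  have h := (((hsq.neg.div_const ((L : ℂ) ^ 2)).add
    (((hsq.const_mul Complex.I).mul_const (U : ℂ)).div_const (L : ℂ))).add_const
      (Complex.I * (φ : ℂ))).cexp.const_mul (A : ℂ)
  refine h.congr_deriv ?_
  simp only [Pi.add_apply, Pi.neg_apply, Pi.pow_apply, id]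
  generalize Complex.exp _ = E
  push_cast
  ring

theorem im_mul_mul_conj (z w : ℂ) : (z * w * (starRingEnd ℂ) w).im = z.im * ‖w‖ ^ 2 := by
  rw [mul_assoc, Complex.mul_conj', ← Complex.ofReal_pow, Complex.im_mul_ofReal]

/-- The NLS Lagrangian in the co-moving frame, evaluated at the Gaussian ansatz
`v(x,t) = A(t) exp(−x²/L(t)² + i x² U(t)/L(t) + i φ(t))`, equals the reduced Lagrangian
`(√π A²/(16L)) [√2(−2L³U̇ + L²(2L̇U + U² − 8φ̇) + 1) − 2A²L²]`. -/
theorem stmt10 (A L U φ : ℝ → ℝ)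
    (hA : Differentiable ℝ A) (hL : Differentiable ℝ L)
    (hU : Differentiable ℝ U) (hφ : Differentiable ℝ φ)
    (hApos : ∀ t, 0 < A t) (hLpos : ∀ t, 0 < L t) :
    let v : ℝ → ℝ → ℂ := fun x t =>
      (A t : ℂ) * Complex.exp (-(x : ℂ) ^ 2 / (L t : ℂ) ^ 2
        + Complex.I * (x : ℂ) ^ 2 * (U t : ℂ) / (L t : ℂ) + Complex.I * (φ t : ℂ))
    ∀ t : ℝ,
      (∫ x : ℝ,
        (-(deriv (fun s => v x s) t * (starRingEnd ℂ) (v x t)).im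
          + (1 / 8 : ℝ) * ‖deriv (fun y => v y t) x‖ ^ 2
          - (1 / 4 : ℝ) * ‖v x t‖ ^ 4))
      = Real.sqrt π * (A t) ^ 2 / (16 * L t) *
          (Real.sqrt 2 * (-2 * (L t) ^ 3 * deriv U t
            + (L t) ^ 2 * (2 * deriv L t * U t + (U t) ^ 2 - 8 * deriv φ t) + 1)
          - 2 * (A t) ^ 2 * (L t) ^ 2) := by
  intro v t
  have hl := hLpos t
  have hintegrand (x : ℝ) :
      -(deriv (fun s => v x s) t * (starRingEnd ℂ) (v x t)).im
          + (1 / 8 : ℝ) * ‖deriv (fun y => v y t) x‖ ^ 2 - (1 / 4 : ℝ) * ‖v x t‖ ^ 4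
        = A t ^ 2 * ((1 / L t ^ 4 + U t ^ 2 / L t ^ 2) / 2
              - (deriv U t * L t - U t * deriv L t) / L t ^ 2)
            * (x ^ 2 * exp (-(2 / L t ^ 2) * x ^ 2))
          + -(A t ^ 2 * deriv φ t) * exp (-(2 / L t ^ 2) * x ^ 2)
          - A t ^ 4 / 4 * exp (-(4 / L t ^ 2) * x ^ 2) := by
    have htime : deriv (fun s => v x s) t = _ * v x t :=
      (hasDerivAt_gaussian_ansatz_time x (hA t).hasDerivAt (hL t).hasDerivAt
        (hU t).hasDerivAt (hφ t).hasDerivAt (hApos t).ne' hl.ne').deriv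
    have hspace : deriv (fun y => v y t) x = _ * v x t :=
      (hasDerivAt_gaussian_ansatz_space (A t) (L t) (U t) (φ t) x).deriv
    have hnorm : ‖v x t‖ = A t * exp (-x ^ 2 / L t ^ 2) :=
      norm_gaussian_ansatz _ _ _ _ _ (hApos t).le
    have hexp₂ : exp (-(2 / L t ^ 2) * x ^ 2) = exp (-x ^ 2 / L t ^ 2) ^ 2 := by
      rw [← Real.exp_nat_mul]
      congr 1
      push_cast
      ring
    have hexp₄ : exp (-(4 / L t ^ 2) * x ^ 2) = exp (-x ^ 2 / L t ^ 2) ^ 4 := by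
      rw [← Real.exp_nat_mul]
      congr 1
      push_cast
      ring
    rw [htime, hspace, im_mul_mul_conj, norm_mul _ (v x t), mul_pow ‖_‖, hnorm, Complex.sq_norm,
      Complex.normSq_add_mul_I, hexp₂, hexp₄, Complex.add_im, Complex.ofReal_im, Complex.im_ofReal_mul, Complex.I_im]
    ring
  have hb₂ : 0 < 2 / L t ^ 2 := by positivity
  have hb₄ : 0 < 4 / L t ^ 2 := by positivity
  have hsqrt₂ : √(π / (2 / L t ^ 2)) = √π * √2 * L t / 2 := by
    rw [Real.sqrt_eq_iff_mul_self_eq (by positivity) (by positivity)]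
    field_simp
    simp only [Real.sq_sqrt pi_pos.le, Real.sq_sqrt zero_le_two]
  have hsqrt₄ : √(π / (4 / L t ^ 2)) = √π * L t / 2 := by
    rw [Real.sqrt_eq_iff_mul_self_eq (by positivity) (by positivity)]
    field_simp
    simp only [Real.sq_sqrt pi_pos.le]
    ring
  have hi₁ := (integrable_sq_mul_exp_neg_mul_sq hb₂).const_mul
    (A t ^ 2 * ((1 / L t ^ 4 + U t ^ 2 / L t ^ 2) / 2
      - (deriv U t * L t - U t * deriv L t) / L t ^ 2))
  have hi₂ := (integrable_exp_neg_mul_sq hb₂).const_mul (-(A t ^ 2 * deriv φ t))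
  have hi₃ := (integrable_exp_neg_mul_sq hb₄).const_mul (A t ^ 4 / 4)
  simp_rw [hintegrand]
  rw [integral_sub (hi₁.fun_add hi₂) hi₃, integral_add hi₁ hi₂, integral_const_mul,
    integral_const_mul, integral_const_mul, integral_sq_mul_exp_neg_mul_sq hb₂,
    integral_gaussian, integral_gaussian, hsqrt₂, hsqrt₄]
  field_simp
  ring
end

section
/- Let q = (A, L, U, φ, x_c) : ℝ → ℝ⁵ be differentiable with A(t) > 0 and L(t) > 0 for all t, and let v(x, t) = A(t)·exp(−(x − x_c(t))²/L(t)² + i (x − x_c(t))² U(t)/L(t) + i φ(t)). Then for every t, ∫_ℝ [ −Im(∂v/∂t · v*) − (1/2) Im(∂v/∂x · v*) + (1/8)|∂v/∂x|² − (1/4)|v|⁴ ] dx = (√π A² / (16 L)) · [ √2·( −2 L³ U̇ + L² (2 L̇ U + U² − 8 φ̇) + 1 ) − 2 A² L² ]; in particular the value is independent of x_c(t) and of ẋ_c(t). -/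
open MeasureTheory Real

theorem integral_mul_exp_neg_mul_sq_eq_zero {b : ℝ} (hb : 0 < b) :
    ∫ x : ℝ, x * exp (-b * x ^ 2) = 0 := by
  have hderiv : ∀ x : ℝ, HasDerivAt (fun y : ℝ => exp (-b * y ^ 2))
      (-2 * b * (x * exp (-b * x ^ 2))) x := fun x => by
    refine ((hasDerivAt_pow 2 x).const_mul (-b)).exp.congr_deriv ?_
    norm_num
    ring
  have h := integral_eq_zero_of_hasDerivAt_of_integrable hderiv
    ((integrable_mul_exp_neg_mul_sq hb).const_mul _) (integrable_exp_neg_mul_sq hb)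
  rw [integral_const_mul] at h
  exact (mul_eq_zero.mp h).resolve_left (by simp [hb.ne'])

theorem integral_quadratic_mul_gaussian {b : ℝ} (hb : 0 < b) (c₀ c₁ c₂ d a : ℝ) :
    ∫ x : ℝ, ((c₀ + c₁ * (x - a) + c₂ * (x - a) ^ 2) * exp (-b * (x - a) ^ 2)
        + d * exp (-(2 * b) * (x - a) ^ 2))
      = c₀ * √(π / b) + c₂ * (√(π / b) / (2 * b)) + d * √(π / (2 * b)) := by
  rw [integral_sub_right_eq_self (fun x : ℝ => (c₀ + c₁ * x + c₂ * x ^ 2) * exp (-b * x ^ 2)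
        + d * exp (-(2 * b) * x ^ 2)) a]
  have h0 := (integrable_exp_neg_mul_sq hb).const_mul c₀
  have h1 := (integrable_mul_exp_neg_mul_sq hb).const_mul c₁
  have h2 := (integrable_sq_mul_exp_neg_mul_sq hb).const_mul c₂
  have h3 := (integrable_exp_neg_mul_sq (b := 2 * b) (by positivity)).const_mul d
  simp only [add_mul, mul_assoc c₁, mul_assoc c₂]
  rw [integral_add ((h0.fun_add h1).fun_add h2) h3, integral_add (h0.fun_add h1) h2, integral_add h0 h1]
  simp only [integral_const_mul, integral_gaussian, integral_mul_exp_neg_mul_sq_eq_zero hb,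
    integral_sq_mul_exp_neg_mul_sq hb]
  ring

/-- The NLS Lagrangian in the stationary frame (γ = 1), evaluated at the translating
Gaussian ansatz `v(x,t) = A exp(−(x−x_c)²/L² + i (x−x_c)² U/L + i φ)`, equals the same
reduced Lagrangian as in the co-moving frame; in particular the value is independent of
`x_c(t)` and of `ẋ_c(t)`. -/
theorem stmt11 (A L U φ xc : ℝ → ℝ)
    (hA : Differentiable ℝ A) (hL : Differentiable ℝ L)
    (hU : Differentiable ℝ U) (hφ : Differentiable ℝ φ) (hxc : Differentiable ℝ xc)
    (hApos : ∀ t, 0 < A t) (hLpos : ∀ t, 0 < L t) :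
    let v : ℝ → ℝ → ℂ := fun x t =>
      (A t : ℂ) * Complex.exp (-((x : ℂ) - (xc t : ℂ)) ^ 2 / (L t : ℂ) ^ 2
        + Complex.I * ((x : ℂ) - (xc t : ℂ)) ^ 2 * (U t : ℂ) / (L t : ℂ)
        + Complex.I * (φ t : ℂ))
    ∀ t : ℝ,
      (∫ x : ℝ,
        (-(deriv (fun s => v x s) t * (starRingEnd ℂ) (v x t)).im
          - (1 / 2 : ℝ) * (deriv (fun y => v y t) x * (starRingEnd ℂ) (v x t)).im
          + (1 / 8 : ℝ) * ‖deriv (fun y => v y t) x‖ ^ 2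
          - (1 / 4 : ℝ) * ‖v x t‖ ^ 4))
      = Real.sqrt π * (A t) ^ 2 / (16 * L t) *
          (Real.sqrt 2 * (-2 * (L t) ^ 3 * deriv U t
            + (L t) ^ 2 * (2 * deriv L t * U t + (U t) ^ 2 - 8 * deriv φ t) + 1)
          - 2 * (A t) ^ 2 * (L t) ^ 2) := by
  intro v t
  have hl : L t ≠ 0 := (hLpos t).ne'
  have hlp := hLpos t
  have hb : 0 < 2 / L t ^ 2 := by positivity
  have ha : (A t : ℂ) ≠ 0 := by exact_mod_cast (hApos t).ne'
  have hlc : (L t : ℂ) ≠ 0 := by exact_mod_cast hl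
  -- the phase has the form `ρ + i θ` with `ρ`, `θ` real
  have hv : v = fun x t => (A t : ℂ) * Complex.exp
      (((-(x - xc t) ^ 2 / L t ^ 2 : ℝ) : ℂ)
        + (((x - xc t) ^ 2 * U t / L t + φ t : ℝ) : ℂ) * Complex.I) := by
    funext x s
    simp only [v]
    congr 2
    push_cast
    ring
  have hnorm : ∀ x, ‖v x t‖ = A t * exp (-(x - xc t) ^ 2 / L t ^ 2) := fun x => by
    rw [hv]
    simp only [norm_mul, Complex.norm_exp, Complex.norm_real, norm_eq_abs, abs_of_pos (hApos t)]
    simp [-Complex.ofReal_div, -Complex.ofReal_neg, -Complex.ofReal_pow, -Complex.ofReal_sub,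
      -Complex.ofReal_mul, -Complex.ofReal_add]
  have hnsq : ∀ x, Complex.normSq (v x t) = A t ^ 2 * exp (-(2 / L t ^ 2) * (x - xc t) ^ 2) :=
    fun x => by
      rw [Complex.normSq_eq_norm_sq, hnorm, mul_pow, ← exp_nat_mul]
      congr 2
      push_cast
      ring
  have hdt : ∀ x, deriv (fun s => v x s) t =
      (((deriv A t / A t + (2 * (x - xc t) * deriv xc t / L t ^ 2
          + 2 * (x - xc t) ^ 2 * deriv L t / L t ^ 3) : ℝ) : ℂ)
        + ((-(2 * (x - xc t) * deriv xc t * U t / L t)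
          + (x - xc t) ^ 2 * (deriv U t * L t - U t * deriv L t) / L t ^ 2
          + deriv φ t : ℝ) : ℂ) * Complex.I) * v x t := fun x => by
    have hA' := (hA t).hasDerivAt
    have hL' := (hL t).hasDerivAt
    have hU' := (hU t).hasDerivAt
    have hφ' := (hφ t).hasDerivAt
    have hy := ((hxc t).hasDerivAt.const_sub x).pow 2
    have hρ := (hy.neg.div (hL'.pow 2) (pow_ne_zero 2 hl)).ofReal_comp
    have hθ := (((hy.mul hU').div hL' hl).add hφ').ofReal_comp
    have h := hA'.ofReal_comp.mul (hρ.add (hθ.mul_const Complex.I)).cexp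
    rw [hv]
    refine (h.congr_deriv ?_).deriv
    simp
    field_simp
    ring
  have hdx : ∀ x, deriv (fun y => v y t) x =
      (((-(2 * (x - xc t) / L t ^ 2) : ℝ) : ℂ)
        + ((2 * (x - xc t) * U t / L t : ℝ) : ℂ) * Complex.I) * v x t := fun x => by
    have hy := ((hasDerivAt_id x).sub_const (xc t)).pow 2
    have hρ := (hy.neg.div_const (L t ^ 2)).ofReal_comp
    have hθ := (((hy.mul_const (U t)).div_const (L t)).add_const (φ t)).ofReal_comp
    have h := (hρ.add (hθ.mul_const Complex.I)).cexp.const_mul (A t : ℂ)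
    rw [hv]
    refine (h.congr_deriv ?_).deriv
    simp
    field_simp
  have him : ∀ (p q : ℝ) (z : ℂ), ((((p : ℂ) + (q : ℂ) * Complex.I) * z)
      * (starRingEnd ℂ) z).im = q * Complex.normSq z := fun p q z => by
    rw [mul_assoc, Complex.mul_conj, Complex.im_mul_ofReal]
    simp
  have hsq : ∀ (p q : ℝ) (z : ℂ), ‖((p : ℂ) + (q : ℂ) * Complex.I) * z‖ ^ 2
      = (p ^ 2 + q ^ 2) * Complex.normSq z := fun p q z => by
    rw [norm_mul, mul_pow, ← Complex.normSq_eq_norm_sq, ← Complex.normSq_eq_norm_sq,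
      Complex.normSq_add_mul_I]
  have hquart : ∀ x, ‖v x t‖ ^ 4 = A t ^ 4 * exp (-(2 * (2 / L t ^ 2)) * (x - xc t) ^ 2) :=
    fun x => by
      rw [hnorm, mul_pow, ← exp_nat_mul]
      congr 2
      push_cast
      ring
  have hint := integral_quadratic_mul_gaussian hb (-(A t ^ 2 * deriv φ t))
    (A t ^ 2 * (2 * deriv xc t * U t / L t - U t / L t))
    (A t ^ 2 * (-((deriv U t * L t - U t * deriv L t) / L t ^ 2)
      + 1 / 2 * (1 / L t ^ 4 + U t ^ 2 / L t ^ 2)))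
    (-(1 / 4 * A t ^ 4)) (xc t)
  have hs1 : √(π / (2 / L t ^ 2)) = √π * √2 * L t / 2 := by
    rw [sqrt_eq_iff_mul_self_eq (by positivity) (by positivity)]
    field_simp
    rw [sq_sqrt pi_pos.le, sq_sqrt zero_le_two]
  have hs2 : √(π / (2 * (2 / L t ^ 2))) = √π * L t / 2 := by
    rw [sqrt_eq_iff_mul_self_eq (by positivity) (by positivity)]
    field_simp
    rw [sq_sqrt pi_pos.le]
  rw [hs1, hs2] at hint
  convert hint using 1
  · congr 1
    funext x
    rw [hdt, hdx, him, him, hsq, hquart, hnsq]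
    field_simp
    ring
  · field_simp
    ring
end

section
/- Define L̂ : {(A, L, U, φ, Ȧ, L̇, U̇, φ̇) ∈ ℝ⁸ : A > 0, L > 0} → ℝ by L̂ = (√π A² / (16 L)) · [ √2·( −2 L³ U̇ + L² (2 L̇ U + U² − 8 φ̇) + 1 ) − 2 A² L² ]. Let q = (A, L, U, φ) : ℝ → ℝ⁴ be twice differentiable with A(t) > 0, L(t) > 0 for all t. Then q satisfies the four Euler–Lagrange equations (d/dt)[∂L̂/∂q̇_k (q(t), q̇(t))] = ∂L̂/∂q_k (q(t), q̇(t)), k = 1, …, 4, for all t if and only if q satisfies the system Ȧ = A U/(4L), L̇ = −U/2, U̇ = (√2 A² L² − 2)/(4 L³), φ̇ = 1/(4L²) − 5A²/(8√2) for all t. -/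
open Real

/-- The Lagrangian of the nonlinear Schrödinger equation evaluated on the chirped Gaussian ansatz. -/
noncomputable def gaussianLagrangian (a l u _p _da dl du dp : ℝ) : ℝ :=
  √π * a ^ 2 / (16 * l) *
    (√2 * (-2 * l ^ 3 * du + l ^ 2 * (2 * dl * u + u ^ 2 - 8 * dp) + 1) - 2 * a ^ 2 * l ^ 2)

namespace gaussianLagrangian

variable {a l : ℝ} (u p da dl du dp : ℝ)

theorem deriv_amplitude :
    deriv (fun y => gaussianLagrangian y l u p da dl du dp) a =
      √π * a / (8 * l) * (√2 * (-2 * l ^ 3 * du + l ^ 2 * (2 * dl * u + u ^ 2 - 8 * dp) + 1)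
        - 4 * a ^ 2 * l ^ 2) := by
  have h := (((hasDerivAt_pow 2 a).const_mul √π).div_const (16 * l)).mul
    ((((hasDerivAt_pow 2 a).const_mul 2).mul_const (l ^ 2)).const_sub
      (√2 * (-2 * l ^ 3 * du + l ^ 2 * (2 * dl * u + u ^ 2 - 8 * dp) + 1)))
  refine (h.congr_deriv ?_).deriv
  push_cast
  ring

theorem deriv_width (hl : l ≠ 0) :
    deriv (fun y => gaussianLagrangian a y u p da dl du dp) l =
      √π * a ^ 2 / 16 * (√2 * (-4 * l * du + (2 * dl * u + u ^ 2 - 8 * dp) - 1 / l ^ 2)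
        - 2 * a ^ 2) := by
  have h := (((hasDerivAt_id l).const_mul 16).fun_inv (by simpa using hl)).const_mul
    (√π * a ^ 2) |>.mul
    (((((hasDerivAt_pow 3 l).const_mul (-2)).mul_const du).add
      ((hasDerivAt_pow 2 l).mul_const (2 * dl * u + u ^ 2 - 8 * dp))).add_const 1
        |>.const_mul √2 |>.sub ((hasDerivAt_pow 2 l).const_mul (2 * a ^ 2)))
  refine (h.congr_deriv ?_).deriv
  simp only [id, Pi.add_apply, Pi.sub_apply]
  push_cast
  field_simp
  ring

theorem deriv_chirp (hl : l ≠ 0) :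
    deriv (fun y => gaussianLagrangian a l y p da dl du dp) u =
      √π * √2 / 8 * (a ^ 2 * l * (dl + u)) := by
  have h := (((((hasDerivAt_id u).const_mul (2 * dl)).add (hasDerivAt_pow 2 u)).sub_const
    (8 * dp)).const_mul (l ^ 2)).const_add (-2 * l ^ 3 * du) |>.add_const 1
      |>.const_mul √2 |>.sub_const (2 * a ^ 2 * l ^ 2) |>.const_mul (√π * a ^ 2 / (16 * l))
  refine (h.congr_deriv ?_).deriv
  push_cast
  field_simp
  ring

theorem deriv_phase :
    deriv (fun y => gaussianLagrangian a l u y da dl du dp) p = 0 :=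
  deriv_const _ _

theorem momentum_amplitude :
    deriv (fun y => gaussianLagrangian a l u p y dl du dp) da = 0 :=
  deriv_const _ _

theorem momentum_width (hl : l ≠ 0) :
    deriv (fun y => gaussianLagrangian a l u p da y du dp) dl =
      √π * √2 / 8 * (a ^ 2 * l * u) := by
  have h := ((((((hasDerivAt_id dl).const_mul 2).mul_const u).add_const (u ^ 2)).sub_const
    (8 * dp)).const_mul (l ^ 2)).const_add (-2 * l ^ 3 * du) |>.add_const 1
      |>.const_mul √2 |>.sub_const (2 * a ^ 2 * l ^ 2) |>.const_mul (√π * a ^ 2 / (16 * l))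
  refine (h.congr_deriv ?_).deriv
  field_simp
  ring

theorem momentum_chirp (hl : l ≠ 0) :
    deriv (fun y => gaussianLagrangian a l u p da dl y dp) du =
      -(√π * √2 / 8) * (a ^ 2 * l ^ 2) := by
  have h := (((hasDerivAt_id du).const_mul (-2 * l ^ 3)).add_const
    (l ^ 2 * (2 * dl * u + u ^ 2 - 8 * dp))).add_const 1
      |>.const_mul √2 |>.sub_const (2 * a ^ 2 * l ^ 2) |>.const_mul (√π * a ^ 2 / (16 * l))
  refine (h.congr_deriv ?_).deriv
  field_simp
  ring

theorem momentum_phase (hl : l ≠ 0) :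
    deriv (fun y => gaussianLagrangian a l u p da dl du y) dp =
      -(√π * √2 / 2) * (a ^ 2 * l) := by
  have h := ((((hasDerivAt_id dp).const_mul 8).const_sub (2 * dl * u + u ^ 2)).const_mul
    (l ^ 2)).const_add (-2 * l ^ 3 * du) |>.add_const 1
      |>.const_mul √2 |>.sub_const (2 * a ^ 2 * l ^ 2) |>.const_mul (√π * a ^ 2 / (16 * l))
  refine (h.congr_deriv ?_).deriv
  field_simp
  ring

end gaussianLagrangian

/-- The algebraic solution of the Euler–Lagrange equations for the velocities, where `c` and `r`
stand for `√π` and `√2`. -/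
theorem eulerLagrange_iff_velocities {c r a l : ℝ} (hc : c ≠ 0) (hr : r ^ 2 = 2) (ha : a ≠ 0)
    (hl : l ≠ 0) (u da dl du dp : ℝ) :
    (0 = c * a / (8 * l) * (r * (-2 * l ^ 3 * du + l ^ 2 * (2 * dl * u + u ^ 2 - 8 * dp) + 1)
        - 4 * a ^ 2 * l ^ 2) ∧
      c * r / 8 * ((2 * a * da * l + a ^ 2 * dl) * u + a ^ 2 * l * du) =
        c * a ^ 2 / 16 * (r * (-4 * l * du + (2 * dl * u + u ^ 2 - 8 * dp) - 1 / l ^ 2)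
          - 2 * a ^ 2) ∧
      -(c * r / 8) * (2 * a * da * l ^ 2 + a ^ 2 * (2 * l * dl)) =
        c * r / 8 * (a ^ 2 * l * (dl + u)) ∧
      -(c * r / 2) * (2 * a * da * l + a ^ 2 * dl) = 0) ↔
    da = a * u / (4 * l) ∧ dl = -u / 2 ∧ du = (r * a ^ 2 * l ^ 2 - 2) / (4 * l ^ 3) ∧
      dp = 1 / (4 * l ^ 2) - 5 * a ^ 2 / (8 * r) := by
  have hr0 : r ≠ 0 := by rintro rfl; norm_num at hr
  constructor
  · rintro ⟨h1, h2, h3, h4⟩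
    have e4 : 2 * da * l + a * dl = 0 := by
      have : (c * r / 2 * a) * (2 * da * l + a * dl) = 0 := by linear_combination -h4
      exact (mul_eq_zero.mp this).resolve_left (by positivity)
    have e3 : dl = -u / 2 := by
      have : (c * r / 8 * a ^ 2 * l) * (2 * dl + u) = 0 := by
        linear_combination -h3 - (c * r / 8 * a * l) * e4
      have := (mul_eq_zero.mp this).resolve_left (by positivity)
      linear_combination this / 2
    subst e3
    have e1 : r * (-2 * l ^ 3 * du - 8 * l ^ 2 * dp + 1) - 4 * a ^ 2 * l ^ 2 = 0 := by
      have : (c * a / (8 * l)) *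
          (r * (-2 * l ^ 3 * du - 8 * l ^ 2 * dp + 1) - 4 * a ^ 2 * l ^ 2) = 0 := by
        linear_combination -h1
      exact (mul_eq_zero.mp this).resolve_left (by positivity)
    have e2 : r * (-6 * l ^ 3 * du - 8 * l ^ 2 * dp - 1) - 2 * a ^ 2 * l ^ 2 = 0 := by
      have h : (1 / l ^ 2) * l ^ 2 = 1 := by field_simp
      have : (c * a ^ 2 / 16) *
          (r * (-6 * l ^ 3 * du - 8 * l ^ 2 * dp - 1) - 2 * a ^ 2 * l ^ 2) = 0 := by
        linear_combination -l ^ 2 * h2 + (c * r / 8 * a * u * l ^ 2) * e4 +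
          (c * a ^ 2 / 16 * r) * h
      exact (mul_eq_zero.mp this).resolve_left (by positivity)
    have e5 : 4 * l ^ 3 * du = r * a ^ 2 * l ^ 2 - 2 := by
      linear_combination (r / 2) * (e1 - e2) - (2 * l ^ 3 * du + 1) * hr
    refine ⟨?_, rfl, ?_, ?_⟩
    · field_simp
      linear_combination 2 * e4
    · field_simp
      linear_combination e5
    · field_simp
      linear_combination -4 * e1 - 2 * r * e5 - 2 * a ^ 2 * l ^ 2 * hr
  · rintro ⟨rfl, rfl, rfl, rfl⟩
    refine ⟨?_, ?_, ?_, ?_⟩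
    · field_simp
      linear_combination 2 * l ^ 2 * c * a ^ 3 * hr
    · field_simp
      linear_combination 96 * a ^ 2 * l ^ 2 * hr
    · field_simp
      ring
    · field_simp
      ring

/-- The Euler–Lagrange equations of the reduced Lagrangian
`L̂(A,L,U,φ,Ȧ,L̇,U̇,φ̇) = (√π A²/(16L))[√2(−2L³U̇ + L²(2L̇U + U² − 8φ̇) + 1) − 2A²L²]`
hold along a twice differentiable curve `q = (A,L,U,φ)` with `A, L > 0` if and only if
`q` solves the first-order system `Ȧ = AU/(4L)`, `L̇ = −U/2`,
`U̇ = (√2 A²L² − 2)/(4L³)`, `φ̇ = 1/(4L²) − 5A²/(8√2)`. -/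
theorem stmt12 (A L U φ : ℝ → ℝ)
    (hA : Differentiable ℝ A) (hA' : Differentiable ℝ (deriv A))
    (hL : Differentiable ℝ L) (hL' : Differentiable ℝ (deriv L))
    (hU : Differentiable ℝ U) (hU' : Differentiable ℝ (deriv U))
    (hφ : Differentiable ℝ φ) (hφ' : Differentiable ℝ (deriv φ))
    (hApos : ∀ t, 0 < A t) (hLpos : ∀ t, 0 < L t) :
    let Lhat : ℝ → ℝ → ℝ → ℝ → ℝ → ℝ → ℝ → ℝ → ℝ := fun a l u p da dl du dp =>
      Real.sqrt π * a ^ 2 / (16 * l) *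
        (Real.sqrt 2 * (-2 * l ^ 3 * du + l ^ 2 * (2 * dl * u + u ^ 2 - 8 * dp) + 1)
          - 2 * a ^ 2 * l ^ 2)
    ((∀ t : ℝ,
        deriv (fun s => deriv
          (fun y => Lhat (A s) (L s) (U s) (φ s) y (deriv L s) (deriv U s) (deriv φ s))
          (deriv A s)) t
        = deriv (fun y => Lhat y (L t) (U t) (φ t)
            (deriv A t) (deriv L t) (deriv U t) (deriv φ t)) (A t)) ∧
      (∀ t : ℝ,
        deriv (fun s => deriv
          (fun y => Lhat (A s) (L s) (U s) (φ s) (deriv A s) y (deriv U s) (deriv φ s))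
          (deriv L s)) t
        = deriv (fun y => Lhat (A t) y (U t) (φ t)
            (deriv A t) (deriv L t) (deriv U t) (deriv φ t)) (L t)) ∧
      (∀ t : ℝ,
        deriv (fun s => deriv
          (fun y => Lhat (A s) (L s) (U s) (φ s) (deriv A s) (deriv L s) y (deriv φ s))
          (deriv U s)) t
        = deriv (fun y => Lhat (A t) (L t) y (φ t)
            (deriv A t) (deriv L t) (deriv U t) (deriv φ t)) (U t)) ∧
      (∀ t : ℝ,
        deriv (fun s => deriv
          (fun y => Lhat (A s) (L s) (U s) (φ s) (deriv A s) (deriv L s) (deriv U s) y)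
          (deriv φ s)) t
        = deriv (fun y => Lhat (A t) (L t) (U t) y
            (deriv A t) (deriv L t) (deriv U t) (deriv φ t)) (φ t)))
    ↔ (∀ t : ℝ,
        deriv A t = A t * U t / (4 * L t) ∧
        deriv L t = -U t / 2 ∧
        deriv U t = (Real.sqrt 2 * (A t) ^ 2 * (L t) ^ 2 - 2) / (4 * (L t) ^ 3) ∧
        deriv φ t = 1 / (4 * (L t) ^ 2) - 5 * (A t) ^ 2 / (8 * Real.sqrt 2)) := by
  intro Lhat
  have hLhat : Lhat = gaussianLagrangian := rfl
  have hl t : L t ≠ 0 := (hLpos t).ne'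
  have hAsq t : HasDerivAt (fun s => A s ^ 2) (2 * A t * deriv A t) t :=
    ((hA t).hasDerivAt.fun_pow 2).congr_deriv (by push_cast; ring)
  have hLsq t : HasDerivAt (fun s => L s ^ 2) (2 * L t * deriv L t) t :=
    ((hL t).hasDerivAt.fun_pow 2).congr_deriv (by push_cast; ring)
  have hmass t := (hAsq t).fun_mul (hL t).hasDerivAt
  have hphase t := ((hmass t).const_mul (-(√π * √2 / 2))).deriv
  have hchirp t := (((hAsq t).fun_mul (hLsq t)).const_mul (-(√π * √2 / 8))).deriv
  have hwidth t := (((hmass t).fun_mul (hU t).hasDerivAt).const_mul (√π * √2 / 8)).deriv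
  simp only [hLhat, gaussianLagrangian.deriv_amplitude, gaussianLagrangian.deriv_width, hl,
    gaussianLagrangian.deriv_chirp, gaussianLagrangian.deriv_phase,
    gaussianLagrangian.momentum_amplitude, gaussianLagrangian.momentum_width,
    gaussianLagrangian.momentum_chirp, gaussianLagrangian.momentum_phase, ne_eq,
    not_false_eq_true, deriv_const, hphase, hchirp, hwidth]
  simp only [← forall_and]
  exact forall_congr' fun t => eulerLagrange_iff_velocities (by positivity)
    (Real.sq_sqrt zero_le_two) (hApos t).ne' (hl t) _ _ _ _ _
end

section
/- Fix A > 0, L > 0, and U, φ₀ ∈ ℝ, and let û(x) = A·exp(−x²/L² + i x² U / L + i φ₀). Let v_A, v_L, v_U, v_φ : ℝ → ℂ denote the partial derivatives of û with respect to the parameters A, L, U, φ₀ respectively, and set c_A = A U/(4L), c_L = −U/2, c_U = (√2 A² L² − 2)/(4 L³), c_φ = 1/(4L²) − 5A²/(8√2). Define the residual r(x) = c_A v_A(x) + c_L v_L(x) + c_U v_U(x) + c_φ v_φ(x) − [ −(i/8) û″(x) − (i/2) |û(x)|² û(x) ]. Then Re ∫_ℝ v_k(x)* · r(x) dx = 0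 for each k ∈ {A, L, U, φ}. -/
open MeasureTheory Real

theorem integrable_pow_mul_exp_neg_mul_sq {b : ℝ} (hb : 0 < b) (n : ℕ) :
    Integrable fun x : ℝ => x ^ n * Real.exp (-b * x ^ 2) := by
  have h := integrable_rpow_mul_exp_neg_mul_sq hb (s := (n : ℝ))
    (by linarith [n.cast_nonneg (α := ℝ)])
  simpa only [Real.rpow_natCast] using h

theorem integral_pow_add_two_mul_exp_neg_mul_sq {b : ℝ} (hb : 0 < b) (n : ℕ) :
    ∫ x : ℝ, x ^ (n + 2) * Real.exp (-b * x ^ 2) =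
      (n + 1) / (2 * b) * ∫ x : ℝ, x ^ n * Real.exp (-b * x ^ 2) := by
  have hu : ∀ x : ℝ, HasDerivAt (fun y : ℝ => y ^ (n + 1)) ((n + 1) * x ^ n) x := fun x => by
    simpa using hasDerivAt_pow (n + 1) x
  have hv : ∀ x : ℝ, HasDerivAt (fun y : ℝ => Real.exp (-b * y ^ 2))
      (-(2 * b) * (x * Real.exp (-b * x ^ 2))) x := fun x => by
    convert (((hasDerivAt_pow 2 x).const_mul (-b)).exp) using 1
    push_cast
    ring
  have h := integral_mul_deriv_eq_deriv_mul_of_integrable (fun x _ => hu x) (fun x _ => hv x)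
    (((integrable_pow_mul_exp_neg_mul_sq hb (n + 2)).const_mul (-(2 * b))).congr
      (.of_forall fun x => by simp only [Pi.mul_apply]; ring))
    (((integrable_pow_mul_exp_neg_mul_sq hb n).const_mul (n + 1 : ℝ)).congr
      (.of_forall fun x => by simp only [Pi.mul_apply]; ring))
    (integrable_pow_mul_exp_neg_mul_sq hb (n + 1))
  have h1 : ∀ x : ℝ, x ^ (n + 1) * (-(2 * b) * (x * Real.exp (-b * x ^ 2))) =
      -(2 * b) * (x ^ (n + 2) * Real.exp (-b * x ^ 2)) := fun x => by ring
  simp only [h1, mul_assoc ((n : ℝ) + 1), integral_const_mul] at h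
  rw [div_mul_eq_mul_div, eq_div_iff (by positivity)]
  linarith

theorem re_integral_eq_zero_of_integral_re {f : ℝ → ℂ} (h : ∫ x, (f x).re = 0) :
    (∫ x, f x).re = 0 := by
  by_cases hf : Integrable f
  · exact (integral_re hf).symm.trans h
  · simp [integral_undef hf]

/-- The profile `S` for which the residual of the Gaussian ansatz `u` equals `i S u`. -/
noncomputable def residualProfile (A L x : ℝ) : ℝ :=
  √2 * A ^ 2 / (4 * L ^ 2) * x ^ 2 - 5 * A ^ 2 / (8 * √2)
    + A ^ 2 / 2 * Real.exp (-(2 / L ^ 2) * x ^ 2)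

theorem integral_gaussian_mul_residualProfile (A : ℝ) {L : ℝ} (hL : 0 < L) :
    (∫ x : ℝ, Real.exp (-(2 / L ^ 2) * x ^ 2) * residualProfile A L x = 0) ∧
    ∫ x : ℝ, x ^ 2 * Real.exp (-(2 / L ^ 2) * x ^ 2) * residualProfile A L x = 0 := by
  have hb : 0 < 2 / L ^ 2 := by positivity
  have hc : 0 < 4 / L ^ 2 := by positivity
  have hbi := integrable_pow_mul_exp_neg_mul_sq hb
  have hci := integrable_pow_mul_exp_neg_mul_sq hc
  have h2 : √2 ^ 2 = (2 : ℝ) := Real.sq_sqrt (by norm_num)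
  have hexp : ∀ x : ℝ, Real.exp (-(4 / L ^ 2) * x ^ 2) =
      Real.exp (-(2 / L ^ 2) * x ^ 2) * Real.exp (-(2 / L ^ 2) * x ^ 2) := fun x => by
    rw [← Real.exp_add]; ring_nf
  have hsplit : ∀ n : ℕ,
      ∫ x : ℝ, x ^ n * Real.exp (-(2 / L ^ 2) * x ^ 2) * residualProfile A L x =
        √2 * A ^ 2 / (4 * L ^ 2) * (∫ x : ℝ, x ^ (n + 2) * Real.exp (-(2 / L ^ 2) * x ^ 2))
        - 5 * A ^ 2 / (8 * √2) * (∫ x : ℝ, x ^ n * Real.exp (-(2 / L ^ 2) * x ^ 2))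
        + A ^ 2 / 2 * (∫ x : ℝ, x ^ n * Real.exp (-(4 / L ^ 2) * x ^ 2)) := fun n => by
    rw [← integral_const_mul, ← integral_const_mul, ← integral_const_mul, ← integral_sub,
      ← integral_add]
    · refine integral_congr_ae (.of_forall fun x => ?_)
      simp only [residualProfile, hexp]
      ring
    · exact ((hbi _).const_mul _).sub ((hbi _).const_mul _)
    · exact (hci _).const_mul _
    · exact (hbi _).const_mul _
    · exact (hbi _).const_mul _
  have hg : ∫ x : ℝ, x ^ 0 * Real.exp (-(2 / L ^ 2) * x ^ 2) =
      √2 * ∫ x : ℝ, x ^ 0 * Real.exp (-(4 / L ^ 2) * x ^ 2) := by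
    simp only [pow_zero, one_mul, integral_gaussian]
    rw [← Real.sqrt_mul (by norm_num)]
    congr 1
    field_simp
    norm_num
  have hs : √2 ≠ 0 := by positivity
  constructor
  · have h := hsplit 0
    rw [integral_pow_add_two_mul_exp_neg_mul_sq hb, hg] at h
    simp only [pow_zero, one_mul] at h
    rw [h]
    field_simp
    push_cast
    rw [h2]
    ring
  · rw [hsplit 2, integral_pow_add_two_mul_exp_neg_mul_sq hb 2,
      integral_pow_add_two_mul_exp_neg_mul_sq hb 0,
      integral_pow_add_two_mul_exp_neg_mul_sq hc 0, hg]
    field_simp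
    push_cast
    rw [h2]
    ring

/-- The RONS parameter velocities for NLS in the co-moving frame with the Gaussian ansatz
make the instantaneous residual `û_t − F(û)` orthogonal, in the real part of the `L²(ℝ,ℂ)`
inner product, to each tangent direction `∂û/∂A, ∂û/∂L, ∂û/∂U, ∂û/∂φ₀`. -/
theorem stmt13 (A L U φ₀ : ℝ) (hA : 0 < A) (hL : 0 < L) :
    let uh : ℝ → ℝ → ℝ → ℝ → ℝ → ℂ := fun a l u p x =>
      (a : ℂ) * Complex.exp (-(x : ℂ) ^ 2 / (l : ℂ) ^ 2
        + Complex.I * (x : ℂ) ^ 2 * (u : ℂ) / (l : ℂ) + Complex.I * (p : ℂ))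
    let vA : ℝ → ℂ := fun x => deriv (fun a => uh a L U φ₀ x) A
    let vL : ℝ → ℂ := fun x => deriv (fun l => uh A l U φ₀ x) L
    let vU : ℝ → ℂ := fun x => deriv (fun u => uh A L u φ₀ x) U
    let vφ : ℝ → ℂ := fun x => deriv (fun p => uh A L U p x) φ₀
    let cA : ℝ := A * U / (4 * L)
    let cL : ℝ := -U / 2
    let cU : ℝ := (Real.sqrt 2 * A ^ 2 * L ^ 2 - 2) / (4 * L ^ 3)
    let cφ : ℝ := 1 / (4 * L ^ 2) - 5 * A ^ 2 / (8 * Real.sqrt 2)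
    let r : ℝ → ℂ := fun x =>
      (cA : ℂ) * vA x + (cL : ℂ) * vL x + (cU : ℂ) * vU x + (cφ : ℂ) * vφ x
        - (-(Complex.I / 8) * deriv (deriv (fun y => uh A L U φ₀ y)) x
           - (Complex.I / 2) * (‖uh A L U φ₀ x‖ : ℂ) ^ 2 * uh A L U φ₀ x)
    (∫ x : ℝ, (starRingEnd ℂ) (vA x) * r x).re = 0 ∧
    (∫ x : ℝ, (starRingEnd ℂ) (vL x) * r x).re = 0 ∧
    (∫ x : ℝ, (starRingEnd ℂ) (vU x) * r x).re = 0 ∧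
    (∫ x : ℝ, (starRingEnd ℂ) (vφ x) * r x).re = 0 := by
  intro uh vA vL vU vφ cA cL cU cφ r
  have hA0 : (A : ℂ) ≠ 0 := by exact_mod_cast hA.ne'
  have hL0 : (L : ℂ) ≠ 0 := by exact_mod_cast hL.ne'
  have hvA : ∀ x, vA x = uh A L U φ₀ x / A := fun x => by
    refine HasDerivAt.deriv ?_
    refine HasDerivAt.congr_deriv ((Complex.ofRealCLM.hasDerivAt (x := A)).mul_const
      (Complex.exp (-(x : ℂ) ^ 2 / (L : ℂ) ^ 2
        + Complex.I * (x : ℂ) ^ 2 * (U : ℂ) / (L : ℂ) + Complex.I * (φ₀ : ℂ)))) ?_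
    simp only [uh, Complex.ofRealCLM_apply, Complex.ofReal_one]
    field_simp
  have hvL : ∀ x, vL x =
      (2 * (x : ℂ) ^ 2 / L ^ 3 - Complex.I * x ^ 2 * U / L ^ 2) * uh A L U φ₀ x := fun x => by
    refine HasDerivAt.deriv ?_
    have hd : HasDerivAt (fun l : ℝ => (l : ℂ)) 1 L := Complex.ofRealCLM.hasDerivAt
    refine HasDerivAt.congr_deriv
      ((((((hasDerivAt_const L (-(x : ℂ) ^ 2)).div (hd.pow 2)
        (pow_ne_zero 2 hL0)).add
      ((hasDerivAt_const L (Complex.I * (x : ℂ) ^ 2 * U)).div hd hL0)).add_const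
        (Complex.I * (φ₀ : ℂ))).cexp.const_mul (A : ℂ))) ?_
    simp only [uh, Pi.add_apply, Pi.div_apply, Pi.pow_apply]
    push_cast
    field_simp
    ring
  have hvU : ∀ x, vU x = Complex.I * (x : ℂ) ^ 2 / L * uh A L U φ₀ x := fun x => by
    refine HasDerivAt.deriv ?_
    have hd : HasDerivAt (fun u : ℝ => (u : ℂ)) 1 U := Complex.ofRealCLM.hasDerivAt
    refine HasDerivAt.congr_deriv
      ((((((hd.const_mul (Complex.I * (x : ℂ) ^ 2)).div_const
        (L : ℂ)).const_add (-(x : ℂ) ^ 2 / (L : ℂ) ^ 2)).add_const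
        (Complex.I * (φ₀ : ℂ))).cexp.const_mul (A : ℂ))) ?_
    simp only [uh]
    ring
  have hvφ : ∀ x, vφ x = Complex.I * uh A L U φ₀ x := fun x => by
    refine HasDerivAt.deriv ?_
    have hd : HasDerivAt (fun p : ℝ => (p : ℂ)) 1 φ₀ := Complex.ofRealCLM.hasDerivAt
    refine HasDerivAt.congr_deriv
      ((((hd.const_mul Complex.I).const_add (-(x : ℂ) ^ 2 / (L : ℂ) ^ 2
        + Complex.I * (x : ℂ) ^ 2 * (U : ℂ) / (L : ℂ))).cexp.const_mul (A : ℂ))) ?_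
    simp only [uh]
    ring
  have hd1 : ∀ x : ℝ, HasDerivAt (fun y : ℝ => uh A L U φ₀ y)
      ((-2 / (L : ℂ) ^ 2 + 2 * Complex.I * U / L) * (x * uh A L U φ₀ x)) x := fun x => by
    have hd : HasDerivAt (fun p : ℝ => (p : ℂ)) 1 x := Complex.ofRealCLM.hasDerivAt
    refine HasDerivAt.congr_deriv
      (((((hd.pow 2).neg.div_const ((L : ℂ) ^ 2)).add
      ((((hd.pow 2).const_mul Complex.I).mul_const (U : ℂ)).div_const (L : ℂ))).add_const
        (Complex.I * (φ₀ : ℂ))).cexp.const_mul (A : ℂ)) ?_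
    simp only [uh, Pi.add_apply, Pi.neg_apply, Pi.pow_apply]
    push_cast
    ring
  have hd2 : ∀ x : ℝ, deriv (deriv (fun y : ℝ => uh A L U φ₀ y)) x =
      ((-2 / (L : ℂ) ^ 2 + 2 * Complex.I * U / L) +
        (-2 / (L : ℂ) ^ 2 + 2 * Complex.I * U / L) ^ 2 * x ^ 2) * uh A L U φ₀ x := fun x => by
    rw [funext fun y => (hd1 y).deriv]
    refine HasDerivAt.deriv ?_
    have hd : HasDerivAt (fun p : ℝ => (p : ℂ)) 1 x := Complex.ofRealCLM.hasDerivAt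
    refine HasDerivAt.congr_deriv
      ((hd.mul (hd1 x)).const_mul (-2 / (L : ℂ) ^ 2 + 2 * Complex.I * U / L)) ?_
    ring
  have hnorm : ∀ x, ‖uh A L U φ₀ x‖ ^ 2 = A ^ 2 * Real.exp (-(2 / L ^ 2) * x ^ 2) := fun x => by
    have hre : (-(x : ℂ) ^ 2 / (L : ℂ) ^ 2
        + Complex.I * (x : ℂ) ^ 2 * (U : ℂ) / (L : ℂ) + Complex.I * (φ₀ : ℂ)).re =
        -x ^ 2 / L ^ 2 := by
      have : (-(x : ℂ) ^ 2 / (L : ℂ) ^ 2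
        + Complex.I * (x : ℂ) ^ 2 * (U : ℂ) / (L : ℂ) + Complex.I * (φ₀ : ℂ)) =
        ((-x ^ 2 / L ^ 2 : ℝ) : ℂ) + ((x ^ 2 * U / L + φ₀ : ℝ) : ℂ) * Complex.I := by
        push_cast; ring
      rw [this, Complex.add_re, Complex.ofReal_re, Complex.re_ofReal_mul, Complex.I_re,
        mul_zero, add_zero]
    simp only [uh]
    rw [norm_mul, Complex.norm_exp, hre, Complex.norm_real, mul_pow, Real.norm_eq_abs, sq_abs,
      ← Real.exp_nat_mul]
    congr 2
    push_cast
    ring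
  have hr : ∀ x, r x = Complex.I * residualProfile A L x * uh A L U φ₀ x := fun x => by
    have hn : (‖uh A L U φ₀ x‖ : ℂ) ^ 2 = A ^ 2 * (Real.exp (-(2 / L ^ 2) * x ^ 2) : ℝ) := by
      exact_mod_cast hnorm x
    simp only [r, hvA, hvL, hvU, hvφ, hd2, hn, cA, cL, cU, cφ, residualProfile]
    generalize Real.exp (-(2 / L ^ 2) * x ^ 2) = G
    generalize uh A L U φ₀ x = w
    have hs : ((√2 : ℝ) : ℂ) ≠ 0 := by
      exact_mod_cast (by positivity : √2 ≠ 0)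
    push_cast
    field_simp
    ring_nf
    simp only [Complex.I_sq, Complex.I_pow_three]
    ring
  have hpair : ∀ (v : ℝ → ℂ) (m : ℝ → ℂ), (∀ x, v x = m x * uh A L U φ₀ x) → ∀ x,
      ((starRingEnd ℂ) (v x) * r x).re =
        A ^ 2 * (m x).im * (Real.exp (-(2 / L ^ 2) * x ^ 2) * residualProfile A L x) := by
    intro v m hv x
    have : (starRingEnd ℂ) (v x) * r x = (starRingEnd ℂ) (m x) * Complex.I *
        ((‖uh A L U φ₀ x‖ ^ 2 * residualProfile A L x : ℝ) : ℂ) := by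
      rw [hv, hr, map_mul]
      push_cast
      rw [← Complex.conj_mul']
      ring
    rw [this, hnorm, Complex.re_mul_ofReal]
    simp
    ring
  obtain ⟨h0, h2⟩ := integral_gaussian_mul_residualProfile A hL
  have horth : ∀ (v : ℝ → ℂ) (m : ℝ → ℂ) (α β : ℝ), (∀ x, v x = m x * uh A L U φ₀ x) →
      ((∀ x, (m x).im = α) ∨ ∀ x, (m x).im = β * x ^ 2) →
      (∫ x : ℝ, (starRingEnd ℂ) (v x) * r x).re = 0 := by
    intro v m α β hv hm
    apply re_integral_eq_zero_of_integral_re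
    simp only [hpair v m hv]
    rcases hm with hm | hm
    · simp only [hm]
      rw [integral_const_mul, h0, mul_zero]
    · have : ∀ x : ℝ, A ^ 2 * (m x).im *
          (Real.exp (-(2 / L ^ 2) * x ^ 2) * residualProfile A L x) = A ^ 2 * β *
          (x ^ 2 * Real.exp (-(2 / L ^ 2) * x ^ 2) * residualProfile A L x) := fun x => by
        rw [hm]; ring
      simp only [this]
      rw [integral_const_mul, h2, mul_zero]
  refine ⟨horth vA (fun _ => ((1 / A : ℝ) : ℂ)) 0 0 (fun x => ?_) (.inl fun x => ?_),
    horth vL (fun x => ((2 * x ^ 2 / L ^ 3 : ℝ) : ℂ) + ((-U / L ^ 2 * x ^ 2 : ℝ) : ℂ) * Complex.I)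
      0 (-U / L ^ 2) (fun x => ?_) (.inr fun x => ?_),
    horth vU (fun x => ((1 / L * x ^ 2 : ℝ) : ℂ) * Complex.I)
      0 (1 / L) (fun x => ?_) (.inr fun x => ?_),
    horth vφ (fun _ => Complex.I) 1 0 hvφ (.inl fun x => Complex.I_im)⟩
  · rw [hvA]; push_cast; ring
  · exact Complex.ofReal_im _
  · rw [hvL]; push_cast; ring
  · simp only [Complex.add_im, Complex.ofReal_im, Complex.im_ofReal_mul, Complex.I_im,
      mul_one, zero_add]
  · rw [hvU]; push_cast; ring
  · exact Complex.im_ofReal_mul _ _ |>.trans (by simp)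
end

section
/- Let (A, L, U, φ) : ℝ → ℝ⁴ be differentiable with A(t) > 0 and L(t) > 0 for all t, satisfying Ȧ = A U/(4L), L̇ = −U/2, U̇ = (√2 A² L² − 2)/(4 L³), and φ̇ = 1/(4L²) − 5A²/(8√2). Then the function t ↦ √π · A(t)² · (√2 (L(t)² U(t)² + 1) − 2 A(t)² L(t)²) / (16 L(t)) is constant; equivalently, the energy I₂ of the Gaussian ansatz is conserved by the reduced-order model. -/
open Real

/-- The reduced-order model of NLS in the co-moving frame (equation (6) of the paper)
conserves the energy of the Gaussian ansatz: along solutions,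
`√π A² (√2 (L² U² + 1) − 2 A² L²)/(16 L)` is constant. -/
theorem stmt16 (A L U φ : ℝ → ℝ)
    (hApos : ∀ t, 0 < A t) (hLpos : ∀ t, 0 < L t)
    (hA : ∀ t, HasDerivAt A (A t * U t / (4 * L t)) t)
    (hL : ∀ t, HasDerivAt L (-U t / 2) t)
    (hU : ∀ t, HasDerivAt U ((Real.sqrt 2 * (A t) ^ 2 * (L t) ^ 2 - 2) / (4 * (L t) ^ 3)) t)
    (hφ : ∀ t, HasDerivAt φ (1 / (4 * (L t) ^ 2) - 5 * (A t) ^ 2 / (8 * Real.sqrt 2)) t) :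
    ∀ t s : ℝ,
      Real.sqrt π * (A t) ^ 2 *
          (Real.sqrt 2 * ((L t) ^ 2 * (U t) ^ 2 + 1) - 2 * (A t) ^ 2 * (L t) ^ 2)
          / (16 * L t)
      = Real.sqrt π * (A s) ^ 2 *
          (Real.sqrt 2 * ((L s) ^ 2 * (U s) ^ 2 + 1) - 2 * (A s) ^ 2 * (L s) ^ 2)
          / (16 * L s) := by
  have key : ∀ t, HasDerivAt (fun t => Real.sqrt π * (A t) ^ 2 *
      (Real.sqrt 2 * ((L t) ^ 2 * (U t) ^ 2 + 1) - 2 * (A t) ^ 2 * (L t) ^ 2)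
      / (16 * L t)) 0 t := by
    intro t
    have hL0 : L t ≠ 0 := (hLpos t).ne'
    have h2 : Real.sqrt 2 ^ 2 = 2 := Real.sq_sqrt (by norm_num)
    have hA2 := (hA t).fun_pow 2
    have hL2 := (hL t).fun_pow 2
    have hU2 := (hU t).fun_pow 2
    have h := ((hA2.const_mul (Real.sqrt π)).fun_mul
      ((((hL2.fun_mul hU2).add_const 1).const_mul (Real.sqrt 2)).fun_sub
        ((hA2.const_mul 2).fun_mul hL2))).fun_div ((hL t).const_mul 16)
        (mul_ne_zero (by norm_num) hL0)
    refine h.congr_deriv ?_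
    field_simp
    ring_nf
    simp only [h2]
    ring
  exact is_const_of_deriv_eq_zero (fun t => (key t).differentiableAt) (fun t => (key t).deriv)
end

section
/- Let (A, L, U, V, φ, x_c) : ℝ → ℝ⁶ be differentiable with A(t) > 0 and L(t) > 0 for all t, satisfying Ȧ = A U (2 − 3V)/(8L), L̇ = U(3V − 2)/4, U̇ = (√2 A² L² (7V + 2) + 6V − 4)/(8L³), V̇ = −A² U/(2√2 L), φ̇ = (1/(32 L²))·( L² ( −5√2 A² (5V + 2) + 6 U² V + 4 (V − 1) V² ) − 6V + 8 ), and ẋ_c = (1/16)·( 5√2 A² + 3/L² + 3U² + V(3V − 4) + 8 ). Then the function t ↦ A(t)² L(t) is constant; equivalently, the RONS reduced-order model for the modified NLS equation preserves the mass of the modified Gaussian ansatz. -/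
open Real

/-- The RONS reduced-order model for the modified NLS equation (equation (30) of the
paper) preserves the mass of the modified Gaussian ansatz: along solutions, `A² L` is
constant. -/
theorem stmt17 (A L U V φ xc : ℝ → ℝ)
    (hApos : ∀ t, 0 < A t) (hLpos : ∀ t, 0 < L t)
    (hA : ∀ t, HasDerivAt A (A t * U t * (2 - 3 * V t) / (8 * L t)) t)
    (hL : ∀ t, HasDerivAt L (U t * (3 * V t - 2) / 4) t)
    (hU : ∀ t, HasDerivAt U
      ((Real.sqrt 2 * (A t) ^ 2 * (L t) ^ 2 * (7 * V t + 2) + 6 * V t - 4)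
        / (8 * (L t) ^ 3)) t)
    (hV : ∀ t, HasDerivAt V (-((A t) ^ 2 * U t) / (2 * Real.sqrt 2 * L t)) t)
    (hφ : ∀ t, HasDerivAt φ
      ((1 / (32 * (L t) ^ 2)) *
        ((L t) ^ 2 * (-5 * Real.sqrt 2 * (A t) ^ 2 * (5 * V t + 2)
            + 6 * (U t) ^ 2 * V t + 4 * (V t - 1) * (V t) ^ 2)
          - 6 * V t + 8)) t)
    (hxc : ∀ t, HasDerivAt xc
      ((1 / 16) * (5 * Real.sqrt 2 * (A t) ^ 2 + 3 / (L t) ^ 2 + 3 * (U t) ^ 2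
        + V t * (3 * V t - 4) + 8)) t) :
    ∀ t s : ℝ, (A t) ^ 2 * L t = (A s) ^ 2 * L s := by
  have hderiv : ∀ t, HasDerivAt (fun t => (A t) ^ 2 * L t) 0 t := by
    intro t
    have hne : L t ≠ 0 := (hLpos t).ne'
    refine (((hA t).pow 2).mul (hL t)).congr_deriv ?_
    simp only [Pi.pow_apply]
    field_simp
    ring
  exact is_const_of_deriv_eq_zero (fun t => (hderiv t).differentiableAt)
    (fun t => (hderiv t).deriv)
end
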